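/- Let k be a field with a non-trivial absolute value |·|. Every bounded multiplicative seminorm on the hybrid field (k, ‖·‖_hyb) is of the form |·|^ε for a unique ε ∈ [0,1] (with |·|^0 the trivial absolute value). In other words, the map ε ↦ |·|^ε is a bijection from [0,1] onto the set of multiplicative seminorms on k bounded by ‖·‖_hyb. -/

import Mathlib

open Classical in
/-- The trivial absolute value on a field: `0 ↦ 0`, nonzero `↦ 1`. -/
noncomputable def trivAbs {k : Type*} [Field k] (a : k) : ℝ := if a = 0 then 0 else 1

lemma trivAbs_of_ne_zero {k : Type*} [Field k] {a : k} (ha : a ≠ 0) : trivAbs a = 1 := if_neg ha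

/-- Away from zero, `|·|^0` follows the usual convention for real powers. -/
lemma ite_trivAbs_rpow_of_ne_zero {k : Type*} [Field k] (f : AbsoluteValue k ℝ) (ε : ℝ)
    {a : k} (ha : a ≠ 0) : (if ε = 0 then trivAbs a else f a ^ ε) = f a ^ ε := by
  split_ifs with h
  · rw [h, Real.rpow_zero, trivAbs_of_ne_zero ha]
  · rfl

/-- A nontrivial absolute value bounded by the hybrid norm of `f` is equivalent to `f`. -/
lemma AbsoluteValue.IsNontrivial.isEquiv_of_le_max_trivAbs {k : Type*} [Field k]
    {f g : AbsoluteValue k ℝ} (hg : g.IsNontrivial)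
    (hgf : ∀ a, g a ≤ max (trivAbs a) (f a)) : g.IsEquiv f := by
  refine isEquiv_of_lt_one_imp hg fun a ha => ?_
  rcases eq_or_ne a 0 with rfl | ha0
  · simp
  have h1 : 1 < g a⁻¹ := by
    rw [map_inv₀]
    exact (one_lt_inv₀ (g.pos ha0)).2 ha
  have h2 := h1.trans_le (hgf a⁻¹)
  rw [trivAbs_of_ne_zero (inv_ne_zero ha0), lt_max_iff, map_inv₀] at h2
  exact (one_lt_inv₀ (f.pos ha0)).1 (h2.resolve_left (lt_irrefl 1))

/-- For a field `k` with a non-trivial absolute value `f`, every multiplicative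
seminorm on `k` bounded by the hybrid norm `max(|·|₀, |·|)` is of the form `|·|^ε`
for a unique `ε ∈ [0,1]` (with `|·|^0` the trivial absolute value). -/
theorem stmt2 {k : Type*} [Field k] (f : AbsoluteValue k ℝ)
    (hf : ∃ a : k, f a ≠ 0 ∧ f a ≠ 1)
    (φ : k → ℝ)
    (hnn : ∀ a : k, 0 ≤ φ a)
    (h0 : φ 0 = 0) (h1 : φ 1 = 1)
    (hmul : ∀ a b : k, φ (a * b) = φ a * φ b)
    (hadd : ∀ a b : k, φ (a + b) ≤ φ a + φ b)
    (hbd : ∀ a : k, φ a ≤ max (trivAbs a) (f a)) :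
    ∃! ε : ℝ, ε ∈ Set.Icc (0 : ℝ) 1 ∧
      φ = fun a => if ε = 0 then trivAbs a else f a ^ ε := by
  have hf' : f.IsNontrivial := by
    obtain ⟨a, ha, ha1⟩ := hf
    exact ⟨a, f.ne_zero_iff.1 ha, ha1⟩
  obtain ⟨b, hb⟩ := hf'.exists_abv_gt_one
  have hb0 : b ≠ 0 := f.pos_iff.1 (one_pos.trans hb)
  refine existsUnique_of_exists_of_unique ?_ ?_
  · have hφ0 (a : k) : φ a = 0 ↔ a = 0 := by
      refine ⟨fun ha => ?_, fun ha => ha ▸ h0⟩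
      by_contra ha0
      have h := hmul a a⁻¹
      rw [mul_inv_cancel₀ ha0, h1, ha, zero_mul] at h
      exact one_ne_zero h
    let g : AbsoluteValue k ℝ :=
      { toFun := φ, map_mul' := hmul, nonneg' := hnn, eq_zero' := hφ0, add_le' := hadd }
    by_cases hg : g.IsNontrivial
    · obtain ⟨c, hc, hcg⟩ := AbsoluteValue.isEquiv_iff_exists_rpow_eq.1
        (hg.isEquiv_of_le_max_trivAbs (f := f) hbd).symm
      have hφ (a : k) : φ a = f a ^ c := (congrFun hcg a).symm
      refine ⟨c, ⟨hc.le, ?_⟩, funext fun a => by rw [if_neg hc.ne', hφ]⟩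
      have h := hbd b
      rw [trivAbs_of_ne_zero hb0, max_eq_right hb.le, hφ] at h
      exact (Real.rpow_le_rpow_left_iff hb).1 (by rwa [Real.rpow_one])
    · refine ⟨0, by simp, funext fun a => ?_⟩
      rw [if_pos rfl]
      rcases eq_or_ne a 0 with rfl | ha
      · rw [h0, trivAbs, if_pos rfl]
      · rw [trivAbs_of_ne_zero ha]
        exact AbsoluteValue.not_isNontrivial_apply hg ha
  · rintro x y ⟨-, hx⟩ ⟨-, hy⟩
    have h := congrFun (hx.symm.trans hy) b
    simp only [ite_trivAbs_rpow_of_ne_zero f _ hb0] at h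
    exact (Real.rpow_right_inj (one_pos.trans hb) hb.ne').1 h
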